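/- arXiv:1306.4766 — 2 statements merged into one kernel-verified Lean document; each statement's English description precedes it below -/
import Mathlib

section
/- For each q ∈ {j + i·j, i + j} ⊆ ℍ[ℚ₂, 2, 5] and each t ∈ {3, 4}, the following hold: (1) there exists r₁ ∈ O_D with ‖N(1 − r₁)‖ = 1/4 such that z = q − r₁·q·(star r₁) satisfies: N(z)·N(q) = c² for some nonzero c ∈ ℚ₂, and ‖N(z)‖ = 2^(−2t)·‖N(q)‖ (i.e., N(z)·N(2^t·q)⁻¹ is a 2-adic unit); and (2) there exists r₂ ∈ O_D with ‖N(1 − r₂)‖ = 1/2 such that z = q − r₂·q·(star r₂) satisfies the same two conditions. -/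
open Quaternion

noncomputable section

/-- `D` is the quaternion algebra `ℍ[ℚ₂, 2, 5]` with `i² = 2`, `j² = 5`, `i·j = -j·i`;
this is the unique quaternion division algebra over `ℚ₂`. -/
abbrev D : Type := ℍ[ℚ_[2], 2, 5]

/-- The basis quaternion `i`. -/
def qi : D := ⟨0, 1, 0, 0⟩

/-- The basis quaternion `j`. -/
def qj : D := ⟨0, 0, 1, 0⟩

/-- `ω = (1 + j)/2`. -/
def qω : D := ⟨1/2, 0, 1/2, 0⟩

/-- The reduced norm `N(q) = q · (star q)` (as a scalar). -/
def qN (q : D) : ℚ_[2] := (q * star q).re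

/-- The reduced trace `T(q) = q + star q = 2·q.re` (as a scalar). -/
def qT (q : D) : ℚ_[2] := 2 * q.re

set_option linter.unusedSimpArgs false

lemma qN_eq (q : D) : qN q = q.re ^ 2 - 2 * q.imI ^ 2 - 5 * q.imJ ^ 2 + 10 * q.imK ^ 2 := by
  simp [qN]; ring

lemma norm_two_pow_mul (k : ℕ) (m : ℤ) (hm : ¬ (2 : ℤ) ∣ m) :
    ‖(2 : ℚ_[2]) ^ k * (m : ℚ_[2])‖ = (1 / 2) ^ k := by
  have h1 : ‖(m : ℚ_[2])‖ = 1 := by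
    have h2 := Padic.norm_intCast_lt_one_iff (p := 2) (k := m)
    have h3 := Padic.norm_int_le_one (p := 2) m
    rcases h3.lt_or_eq with h | h
    · exact absurd (by exact_mod_cast h2.1 h) hm
    · exact h
  have h2 : ‖(2 : ℚ_[2])‖ = 1 / 2 := by
    have := Padic.norm_p (p := 2)
    norm_num at this ⊢
    exact this
  rw [norm_mul, norm_pow, h1, h2, mul_one]

lemma key (q r : D) (t w k : ℕ) (a b e n : ℤ) (C : ℤ)
    (hr : qN r = (a : ℚ_[2]))
    (h1 : qN (1 - r) = (2 : ℚ_[2]) ^ w * (b : ℚ_[2])) (hb : ¬ (2 : ℤ) ∣ b)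
    (hq : qN q = (2 : ℚ_[2]) ^ 0 * (n : ℚ_[2])) (hn : ¬ (2 : ℤ) ∣ n)
    (hz : qN (q - r * q * star r) = (2 : ℚ_[2]) ^ k * (e : ℚ_[2])) (he : ¬ (2 : ℤ) ∣ e)
    (hk : k = 2 * t) (hC : C ≠ 0) (hc : 2 ^ k * e * n = C ^ 2) :
    ‖qN r‖ ≤ 1 ∧ ‖qN (1 - r)‖ = (1 / 2) ^ w ∧
      (∃ c : ℚ_[2], c ≠ 0 ∧ qN (q - r * q * star r) * qN q = c ^ 2) ∧
      ‖qN (q - r * q * star r)‖ = (2 : ℝ) ^ (-(2 * (t : ℤ))) * ‖qN q‖ := by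
  refine ⟨?_, ?_, ⟨(C : ℚ_[2]), by exact_mod_cast hC, ?_⟩, ?_⟩
  · rw [hr]; exact Padic.norm_int_le_one a
  · rw [h1, norm_two_pow_mul _ _ hb]
  · rw [hz, hq, pow_zero, one_mul]; exact_mod_cast hc
  · rw [hz, hq, norm_two_pow_mul _ _ he, norm_two_pow_mul _ _ hn, hk, zpow_neg]
    rw [show (2 * (t : ℤ)) = ((2 * t : ℕ) : ℤ) by push_cast; rfl, zpow_natCast]
    simp

/-- For `q ∈ {j + i·j, i + j}` and `t ∈ {3, 4}` there exist `r₁, r₂ ∈ O_D` with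
`‖N(1 - r₁)‖ = 1/4` and `‖N(1 - r₂)‖ = 1/2` such that in both cases
`z = q - r·q·(star r)` satisfies: `N(z)·N(q)` is a nonzero square and
`‖N(z)‖ = 2^(-2t)·‖N(q)‖`. -/
theorem stmt_8 (q : D) (hq : q = qj + qi * qj ∨ q = qi + qj)
    (t : ℕ) (ht : t = 3 ∨ t = 4) :
    (∃ r₁ : D, ‖qN r₁‖ ≤ 1 ∧ ‖qN (1 - r₁)‖ = 1 / 4 ∧
      (∃ c : ℚ_[2], c ≠ 0 ∧ qN (q - r₁ * q * star r₁) * qN q = c ^ 2) ∧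
      ‖qN (q - r₁ * q * star r₁)‖ = (2 : ℝ) ^ (-(2 * (t : ℤ))) * ‖qN q‖) ∧
    (∃ r₂ : D, ‖qN r₂‖ ≤ 1 ∧ ‖qN (1 - r₂)‖ = 1 / 2 ∧
      (∃ c : ℚ_[2], c ≠ 0 ∧ qN (q - r₂ * q * star r₂) * qN q = c ^ 2) ∧
      ‖qN (q - r₂ * q * star r₂)‖ = (2 : ℝ) ^ (-(2 * (t : ℤ))) * ‖qN q‖) := by
  have half : (1 / 4 : ℝ) = (1 / 2) ^ 2 := by norm_num
  rw [half]
  rcases hq with rfl | rfl <;> rcases ht with rfl | rfl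
  · constructor
    · exact ⟨_, key _ ⟨3, 0, 0, 0⟩ 3 2 6 (9) (1) (5) (5) 40
          (by simp [qN_eq, qi, qj]; try norm_num) (by simp [qN_eq, qi, qj]; try norm_num) (by norm_num)
          (by simp [qN_eq, qi, qj]; try norm_num) (by norm_num)
          (by simp [qN_eq, qi, qj]; try norm_num) (by norm_num) (by norm_num) (by norm_num) (by norm_num)⟩
    · have := key (qj + qi * qj) ⟨-2, 0, -1, -1⟩ 3 1 6 (9) (7) (5) (5) 40
          (by simp [qN_eq, qi, qj]; try norm_num) (by simp [qN_eq, qi, qj]; try norm_num) (by norm_num)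
          (by simp [qN_eq, qi, qj]; try norm_num) (by norm_num)
          (by simp [qN_eq, qi, qj]; try norm_num) (by norm_num) (by norm_num) (by norm_num) (by norm_num)
      rw [pow_one] at this
      exact ⟨_, this⟩
  · constructor
    · exact ⟨_, key _ ⟨7, 0, 0, 0⟩ 4 2 8 (49) (9) (45) (5) 240
          (by simp [qN_eq, qi, qj]; try norm_num) (by simp [qN_eq, qi, qj]; try norm_num) (by norm_num)
          (by simp [qN_eq, qi, qj]; try norm_num) (by norm_num)
          (by simp [qN_eq, qi, qj]; try norm_num) (by norm_num) (by norm_num) (by norm_num) (by norm_num)⟩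
    · have := key (qj + qi * qj) ⟨-2, 0, -3, -3⟩ 4 1 8 (49) (27) (45) (5) 240
          (by simp [qN_eq, qi, qj]; try norm_num) (by simp [qN_eq, qi, qj]; try norm_num) (by norm_num)
          (by simp [qN_eq, qi, qj]; try norm_num) (by norm_num)
          (by simp [qN_eq, qi, qj]; try norm_num) (by norm_num) (by norm_num) (by norm_num) (by norm_num)
      rw [pow_one] at this
      exact ⟨_, this⟩
  · constructor
    · exact ⟨_, key _ ⟨3, 0, 0, 0⟩ 3 2 6 (9) (1) (-7) (-7) 56
          (by simp [qN_eq, qi, qj]; try norm_num) (by simp [qN_eq, qi, qj]; try norm_num) (by norm_num)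
          (by simp [qN_eq, qi, qj]; try norm_num) (by norm_num)
          (by simp [qN_eq, qi, qj]; try norm_num) (by norm_num) (by norm_num) (by norm_num) (by norm_num)⟩
    · have := key (qi + qj) ⟨0, -1, -1, 0⟩ 3 1 6 (-7) (-3) (-7) (-7) 56
          (by simp [qN_eq, qi, qj]; try norm_num) (by simp [qN_eq, qi, qj]; try norm_num) (by norm_num)
          (by simp [qN_eq, qi, qj]; try norm_num) (by norm_num)
          (by simp [qN_eq, qi, qj]; try norm_num) (by norm_num) (by norm_num) (by norm_num) (by norm_num)
      rw [pow_one] at this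
      exact ⟨_, this⟩
  · constructor
    · exact ⟨_, key _ ⟨7, 0, 0, 0⟩ 4 2 8 (49) (9) (-63) (-7) 336
          (by simp [qN_eq, qi, qj]; try norm_num) (by simp [qN_eq, qi, qj]; try norm_num) (by norm_num)
          (by simp [qN_eq, qi, qj]; try norm_num) (by norm_num)
          (by simp [qN_eq, qi, qj]; try norm_num) (by norm_num) (by norm_num) (by norm_num) (by norm_num)⟩
    · have := key (qi + qj) ⟨-4, -3, -3, 0⟩ 4 1 8 (-47) (-19) (-63) (-7) 336
          (by simp [qN_eq, qi, qj]; try norm_num) (by simp [qN_eq, qi, qj]; try norm_num) (by norm_num)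
          (by simp [qN_eq, qi, qj]; try norm_num) (by norm_num)
          (by simp [qN_eq, qi, qj]; try norm_num) (by norm_num) (by norm_num) (by norm_num) (by norm_num)
      rw [pow_one] at this
      exact ⟨_, this⟩
end
end

section
/- Let η ∈ ℍ[ℚ₂, 2, 5] with ‖N(η)‖ = 1/2 and let a₁ ∈ ℍ[ℚ₂, 2, 5] be a pure quaternion with ‖N(a₁)‖ = 1 (a pure unit). Then η·a₁·(star η) is invertible and the reduced trace of 2·(η·a₁·(star η))⁻¹·a₁ lies in 2·ℤ₂, i.e., ‖T(2·(η·a₁·(star η))⁻¹·a₁)‖ ≤ 1/2. -/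
open Quaternion

noncomputable section

lemma aux_unit (u : ℚ_[2]) (hu : ‖u‖ = 1) : ‖u ^ 2 - 5‖ = 1 / 4 := by
  have h1 : ‖u ^ 2 - 1‖ ≤ 1 / 8 := by
    set v : ℤ_[2] := ⟨u, hu.le⟩ with hv
    have hvu : IsUnit v := PadicInt.isUnit_iff.2 (by simpa [hv] using hu)
    have key : ∀ r : ZMod (2 ^ 3), IsUnit r → r ^ 2 - 1 = 0 := by decide
    have h2 := key _ (hvu.map (PadicInt.toZModPow 3))
    have h3 : v ^ 2 - 1 ∈ RingHom.ker (PadicInt.toZModPow (p := 2) 3) := by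
      rw [RingHom.mem_ker]; simpa using h2
    rw [PadicInt.ker_toZModPow, ← PadicInt.norm_le_pow_iff_mem_span_pow] at h3
    have h4 : ‖v ^ 2 - 1‖ = ‖u ^ 2 - 1‖ := by
      rw [PadicInt.norm_def]; push_cast; rfl
    rw [h4] at h3
    norm_num at h3 ⊢
    exact h3
  have h4 : ‖(-4 : ℚ_[2])‖ = 1 / 4 := by
    have : (-4 : ℚ_[2]) = - (2 * 2) := by norm_num
    rw [this, norm_neg, norm_mul]
    have := Padic.norm_p (p := 2)
    norm_num at this ⊢
    rw [this]; norm_num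
  have e : u ^ 2 - 5 = (u ^ 2 - 1) + (-4) := by ring
  rw [e, Padic.add_eq_max_of_ne (by rw [h4]; intro h; linarith), h4]
  exact max_eq_right (by linarith)

lemma norm_two' : ‖(2 : ℚ_[2])‖ = 1 / 2 := by
  have := Padic.norm_p (p := 2)
  norm_num at this ⊢
  exact this

lemma norm_five' : ‖(5 : ℚ_[2])‖ = 1 := by
  have := (Padic.norm_intCast_lt_one_iff (p := 2) (k := 5)).not.2 (by norm_num)
  have h := Padic.norm_int_le_one (p := 2) 5
  push_cast at this h
  exact le_antisymm h (not_lt.1 this)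

lemma aux_sq (t y : ℚ_[2]) : ∃ c : ℚ_[2], ‖t ^ 2 - 5 * y ^ 2‖ = ‖c‖ ^ 2 ∧ ‖t‖ ≤ 2 * ‖c‖ := by
  by_cases h : ‖t‖ = ‖y‖
  · by_cases hy : y = 0
    · subst hy
      have : t = 0 := by simpa using h
      subst this
      exact ⟨0, by simp⟩
    · have hy' : ‖y‖ ≠ 0 := by simpa using hy
      have e : t ^ 2 - 5 * y ^ 2 = ((t / y) ^ 2 - 5) * y ^ 2 := by field_simp
      refine ⟨2 * y, ?_, ?_⟩
      · rw [e, norm_mul, aux_unit _ (by rw [norm_div, h, div_self hy']), norm_mul, norm_two', norm_pow]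
        ring
      · rw [norm_mul, norm_two', h]; linarith
  · have h5 : ‖-(5 * y ^ 2)‖ = ‖y‖ ^ 2 := by
      rw [norm_neg, norm_mul, norm_five', norm_pow, one_mul]
    have e : t ^ 2 - 5 * y ^ 2 = t ^ 2 + -(5 * y ^ 2) := by ring
    have hn : ‖t ^ 2‖ ≠ ‖-(5 * y ^ 2)‖ := by
      rw [h5, norm_pow]
      intro h'
      exact h ((sq_eq_sq₀ (norm_nonneg _) (norm_nonneg _)).1 h')
    rw [e, Padic.add_eq_max_of_ne hn, h5, norm_pow]
    rcases le_total ‖t‖ ‖y‖ with h' | h'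
    · refine ⟨y, max_eq_right (by gcongr), by linarith [norm_nonneg y]⟩
    · refine ⟨t, max_eq_left (by gcongr), by linarith [norm_nonneg t]⟩

lemma aux_par (c d : ℚ_[2]) (hc : c ≠ 0) : ‖c‖ ^ 2 ≠ 1 / 2 * ‖d‖ ^ 2 := by
  intro h
  have hd : d ≠ 0 := by
    rintro rfl
    simp [hc] at h
  rw [Padic.norm_eq_zpow_neg_valuation hc, Padic.norm_eq_zpow_neg_valuation hd] at h
  have e : ((2 : ℝ)) ^ (-c.valuation + -c.valuation) = 2 ^ (-1 + (-d.valuation + -d.valuation)) := by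
    rw [zpow_add₀ (by norm_num), zpow_add₀ (by norm_num) (-1), zpow_add₀ (by norm_num)]
    push_cast at h
    rw [← sq, ← sq, h]; norm_num
  have := zpow_right_injective₀ (by norm_num : (0 : ℝ) < 2) (by norm_num) e
  omega

lemma norm_le_one' (t : ℚ_[2]) (h : ‖t‖ < 2) : ‖t‖ ≤ 1 := by
  by_cases ht : t = 0
  · simp [ht]
  rw [Padic.norm_eq_zpow_neg_valuation ht] at h ⊢
  push_cast at h ⊢
  have h' : (2 : ℝ) ^ (-t.valuation) < 2 ^ (1 : ℤ) := by simpa using h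
  rw [zpow_lt_zpow_iff_right₀ (by norm_num)] at h'
  exact zpow_le_one_of_nonpos₀ (by norm_num) (by omega)

lemma aux_re (q : D) (h : ‖qN q‖ = 1 / 2) : ‖q.re‖ ≤ 1 := by
  obtain ⟨t, x, y, z⟩ := q
  have e : qN ⟨t, x, y, z⟩ = (t ^ 2 - 5 * y ^ 2) + -(2 * (x ^ 2 - 5 * z ^ 2)) := by
    simp [qN]; ring
  obtain ⟨c, hc, hct⟩ := aux_sq t y
  obtain ⟨d, hd, -⟩ := aux_sq x z
  rw [e] at h
  have h2 : ‖-(2 * (x ^ 2 - 5 * z ^ 2))‖ = 1 / 2 * ‖d‖ ^ 2 := by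
    rw [norm_neg, norm_mul, norm_two', hd]
  change ‖t‖ ≤ 1
  apply norm_le_one'
  by_cases hc0 : c = 0
  · subst hc0
    simp at hct
    simp [hct]
  rw [Padic.add_eq_max_of_ne (by rw [hc, h2]; exact aux_par c d hc0), hc, h2] at h
  have := le_max_left (‖c‖ ^ 2) (1 / 2 * ‖d‖ ^ 2)
  rw [h] at this
  nlinarith [norm_nonneg c]

lemma qN_mul (p q : D) : qN (p * q) = qN p * qN q := by
  simp [qN]; ring

lemma qN_star (p : D) : qN (star p) = qN p := by
  simp [qN]

lemma mul_star_self_aux (p : D) : p * star p = (⟨qN p, 0, 0, 0⟩ : D) := by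
  ext <;> simp [qN] <;> ring

lemma star_mul_self_aux (p : D) : star p * p = (⟨qN p, 0, 0, 0⟩ : D) := by
  ext <;> simp [qN] <;> ring

/-- If `‖N(η)‖ = 1/2` and `a₁` is a pure unit, then `η·a₁·(star η)` is invertible and
the reduced trace of `2·(η·a₁·(star η))⁻¹·a₁` lies in `2·ℤ₂`. -/
theorem stmt_13 (η a₁ : D) (hη : ‖qN η‖ = 1 / 2)
    (ha₁pure : star a₁ = -a₁) (ha₁ : ‖qN a₁‖ = 1) :
    ∃ w : D, (η * a₁ * star η) * w = 1 ∧ w * (η * a₁ * star η) = 1 ∧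
      ‖qT (2 * (w * a₁))‖ ≤ 1 / 2 := by
  have hNa0 : qN a₁ ≠ 0 := by intro h; simp [h] at ha₁
  have hNη0 : qN η ≠ 0 := by intro h; simp [h] at hη
  set B := η * a₁ * star η with hB
  have hNB : qN B = qN η ^ 2 * qN a₁ := by
    rw [hB, qN_mul, qN_mul, qN_star]; ring
  have hNB0 : qN B ≠ 0 := by rw [hNB]; positivity
  have hnB : ‖qN B‖ = 1 / 4 := by
    rw [hNB, norm_mul, norm_pow, hη, ha₁]; norm_num
  refine ⟨(qN B)⁻¹ • star B, ?_, ?_, ?_⟩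
  · rw [mul_smul_comm, mul_star_self_aux]
    ext <;> simp [hNB0]
  · rw [smul_mul_assoc, star_mul_self_aux]
    ext <;> simp [hNB0]
  · have h1 := aux_re η hη
    have h2 := aux_re (η * a₁) (by rw [qN_mul, norm_mul, hη, ha₁, mul_one])
    have hre : (star B * a₁).re = 2 * η.re ^ 2 * qN a₁ + 2 * (η * a₁).re ^ 2 - qN (η * a₁) := by
      have h0 : a₁.re = 0 := by
        have := congrArg QuaternionAlgebra.re ha₁pure
        simp at this
        exact self_eq_neg.1 this
      rw [hB]
      obtain ⟨t, x, y, z⟩ := η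
      obtain ⟨r, a, b, c⟩ := a₁
      simp only at h0
      subst h0
      simp [qN]
      ring
    have e : qT (2 * (((qN B)⁻¹ • star B) * a₁)) = 2 * 2 * (qN B)⁻¹ * (star B * a₁).re := by
      rw [smul_mul_assoc, two_mul]
      simp only [qT, QuaternionAlgebra.re_add, QuaternionAlgebra.re_smul, smul_eq_mul]
      ring
    have hb : ‖(star B * a₁).re‖ ≤ 1 / 2 := by
      rw [hre]
      have b1 : ‖2 * η.re ^ 2 * qN a₁‖ ≤ 1 / 2 := by
        rw [norm_mul, norm_mul, ha₁, norm_two', norm_pow]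
        nlinarith [norm_nonneg η.re]
      have b2 : ‖2 * (η * a₁).re ^ 2‖ ≤ 1 / 2 := by
        rw [norm_mul, norm_two', norm_pow]
        nlinarith [norm_nonneg (η * a₁).re]
      have b3 : ‖-qN (η * a₁)‖ ≤ 1 / 2 := by
        rw [norm_neg, qN_mul, norm_mul, hη, ha₁, mul_one]
      rw [sub_eq_add_neg]
      exact (Padic.nonarchimedean _ _).trans
        (max_le ((Padic.nonarchimedean _ _).trans (max_le b1 b2)) b3)
    rw [e, norm_mul, norm_mul, norm_mul, norm_inv, hnB, norm_two']
    linarith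
end
end
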